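/- There is a Π⁰₃ set T ⊆ ℕ that is proper on the infinite ceers such that [T] is neither Σ⁰₃-hard nor Π⁰₃-hard with respect to many-one reducibility. -/

import Mathlib

/-- The `e`-th computably enumerable subset of `ℕ`: the domain of the `e`-th partial
computable function. -/
def W (e : ℕ) : Set ℕ := {n | ((Denumerable.ofNat Nat.Partrec.Code e).eval n).Dom}

/-- A set `S ⊆ ℕ` is Σ⁰₃ if there is a computable predicate `R ⊆ ℕ⁴` with
`n ∈ S ↔ ∃x ∀y ∃z, R n x y z`. -/
def IsSigma03 (S : Set ℕ) : Prop :=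
  ∃ R : ℕ → ℕ → ℕ → ℕ → Bool,
    (Computable fun p : ℕ × ℕ × ℕ × ℕ => R p.1 p.2.1 p.2.2.1 p.2.2.2) ∧
    ∀ n, n ∈ S ↔ ∃ x, ∀ y, ∃ z, R n x y z = true

/-- A binary relation on `ℕ` is Σ⁰₃ if the corresponding set of codes of pairs
(under the standard computable pairing) is Σ⁰₃. -/
def Sigma03Rel (E : ℕ → ℕ → Prop) : Prop :=
  IsSigma03 {p : ℕ | E p.unpair.1 p.unpair.2}

/-- `E` computably reduces to `F`: there is a total computable `Φ` with
`m E n ↔ Φ(m) F Φ(n)`. -/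
def ComputableReduction (E F : ℕ → ℕ → Prop) : Prop :=
  ∃ Φ : ℕ → ℕ, Computable Φ ∧ ∀ m n, E m n ↔ F (Φ m) (Φ n)

/-- A set is Π⁰₃ iff its complement is Σ⁰₃. -/
def IsPi03 (S : Set ℕ) : Prop := IsSigma03 Sᶜ

/-- `E` and `F` are computably equivalent: computable reductions exist in both directions. -/
def CeerEquiv (E F : ℕ → ℕ → Prop) : Prop :=
  ComputableReduction E F ∧ ComputableReduction F E

/-- The fixed uniform enumeration of all ceers: `ceer i` is the equivalence relation
generated by the `i`-th c.e. set `W i` of coded pairs. -/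
def ceer (i : ℕ) : ℕ → ℕ → Prop :=
  Relation.EqvGen fun m n => Nat.pair m n ∈ W i

/-- `[S]`: the closure of a set of indices of ceers under computable equivalence. -/
def ceerClosure (S : Set ℕ) : Set ℕ := {i | ∃ j ∈ S, CeerEquiv (ceer i) (ceer j)}

/-- An equivalence relation on `ℕ` has infinitely many classes iff there is an infinite
family of pairwise inequivalent elements. -/
def HasInfinitelyManyClasses (E : ℕ → ℕ → Prop) : Prop :=
  ∃ f : ℕ → ℕ, ∀ m n, m ≠ n → ¬E (f m) (f n)

/-- `S` is proper on the infinite ceers: some ceer with infinitely many classes has its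
index in `[S]` and some ceer with infinitely many classes has its index outside `[S]`. -/
def ProperOnInfiniteCeers (S : Set ℕ) : Prop :=
  ∃ i j, HasInfinitelyManyClasses (ceer i) ∧ HasInfinitelyManyClasses (ceer j) ∧
    i ∈ ceerClosure S ∧ j ∉ ceerClosure S

open Nat.Partrec Denumerable

attribute [fun_prop] Primrec
attribute [fun_prop] Primrec.id Primrec.const Primrec.comp Primrec.fst Primrec.snd Primrec.pair
  Primrec.encode Primrec.ofNat Primrec.unpair Primrec.list_range Primrec.list_length

section Arithmetical

variable {α β γ : Type*} [Primcodable α] [Denumerable β] [Denumerable γ]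

@[fun_prop]
theorem Primrec.natPair_comp {f g : α → ℕ} (hf : Primrec f) (hg : Primrec g) :
    Primrec fun a => Nat.pair (f a) (g a) := Primrec₂.natPair.comp hf hg

@[fun_prop]
theorem Primrec.getD_zero_comp {f : α → List ℕ} {g : α → ℕ} (hf : Primrec f) (hg : Primrec g) :
    Primrec fun a => (f a).getD (g a) 0 := (Primrec.list_getD 0).comp hf hg

@[fun_prop]
theorem Primrec.add_comp {f g : α → ℕ} (hf : Primrec f) (hg : Primrec g) :
    Primrec fun a => f a + g a := Primrec.nat_add.comp hf hg

@[fun_prop]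
theorem Primrec.sub_comp {f g : α → ℕ} (hf : Primrec f) (hg : Primrec g) :
    Primrec fun a => f a - g a := Primrec.nat_sub.comp hf hg

@[fun_prop]
theorem Primrec.mul_comp {f g : α → ℕ} (hf : Primrec f) (hg : Primrec g) :
    Primrec fun a => f a * g a := Primrec.nat_mul.comp hf hg

@[fun_prop]
theorem Primrec.div_comp {f g : α → ℕ} (hf : Primrec f) (hg : Primrec g) :
    Primrec fun a => f a / g a := Primrec.nat_div.comp hf hg

@[fun_prop]
theorem Primrec.mod_comp {f g : α → ℕ} (hf : Primrec f) (hg : Primrec g) :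
    Primrec fun a => f a % g a := Primrec.nat_mod.comp hf hg

@[fun_prop]
theorem Primrec.evaln_comp {k : α → ℕ} {c : α → Code} {n : α → ℕ} (hk : Primrec k)
    (hc : Primrec c) (hn : Primrec n) : Primrec fun a => Code.evaln (k a) (c a) (n a) :=
  Code.primrec_evaln.comp ((hk.pair hc).pair hn)

theorem Primrec.foldl_comp {σ δ : Type*} [Primcodable σ] [Primcodable δ] {f : α → σ → δ → σ}
    {l : α → List δ} {s : α → σ} (hf : Primrec fun x : α × σ × δ => f x.1 x.2.1 x.2.2)
    (hl : Primrec l) (hs : Primrec s) : Primrec fun a => (l a).foldl (f a) (s a) :=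
  Primrec.list_foldl hl hs (h := fun a x => f a x.1 x.2) hf

theorem PrimrecPred.eq_comp {σ : Type*} [Primcodable σ] [DecidableEq σ] {f g : α → σ}
    (hf : Primrec f) (hg : Primrec g) : PrimrecPred fun a => f a = g a :=
  Primrec.eq.comp hf hg

/-- A Σ⁰₁ predicate, presented with a primitive recursive matrix. -/
def SigmaOne (p : α → Prop) : Prop :=
  ∃ R : α × ℕ → Prop, PrimrecPred R ∧ ∀ a, p a ↔ ∃ z, R (a, z)

namespace SigmaOne

variable {p q : α → Prop}

theorem of_primrecPred (hp : PrimrecPred p) : SigmaOne p :=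
  ⟨fun x => p x.1, hp.comp Primrec.fst, fun a => by simp⟩

theorem congr (hp : SigmaOne p) (h : ∀ a, q a ↔ p a) : SigmaOne q := by
  obtain ⟨R, hR, hpR⟩ := hp
  exact ⟨R, hR, fun a => (h a).trans (hpR a)⟩

theorem comp {δ : Type*} [Primcodable δ] (hp : SigmaOne p) {f : δ → α} (hf : Primrec f) :
    SigmaOne fun a => p (f a) := by
  obtain ⟨R, hR, hpR⟩ := hp
  exact ⟨fun x => R (f x.1, x.2), hR.comp (by fun_prop), fun a => hpR (f a)⟩

theorem exists_denumerable {p : α → β → Prop} (hp : SigmaOne fun x : α × β => p x.1 x.2) :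
    SigmaOne fun a => ∃ b, p a b := by
  obtain ⟨R, hR, hpR⟩ := hp
  refine ⟨fun x => R ((x.1, ofNat β x.2.unpair.1), x.2.unpair.2), hR.comp (by fun_prop),
    fun a => ⟨?_, ?_⟩⟩
  · rintro ⟨b, hb⟩
    obtain ⟨z, hz⟩ := (hpR (a, b)).1 hb
    exact ⟨Nat.pair (Encodable.encode b) z, by simpa using hz⟩
  · rintro ⟨z, hz⟩
    exact ⟨_, (hpR _).2 ⟨_, hz⟩⟩

theorem and (hp : SigmaOne p) (hq : SigmaOne q) : SigmaOne fun a => p a ∧ q a := by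
  obtain ⟨R, hR, hpR⟩ := hp
  obtain ⟨Q, hQ, hqQ⟩ := hq
  refine ⟨fun x => R (x.1, x.2.unpair.1) ∧ Q (x.1, x.2.unpair.2),
    (hR.comp (by fun_prop)).and (hQ.comp (by fun_prop)), fun a => ?_⟩
  simp only [hpR, hqQ]
  constructor
  · rintro ⟨⟨z, hz⟩, w, hw⟩
    exact ⟨Nat.pair z w, by simpa using ⟨hz, hw⟩⟩
  · rintro ⟨z, hz, hw⟩
    exact ⟨⟨_, hz⟩, _, hw⟩

theorem or (hp : SigmaOne p) (hq : SigmaOne q) : SigmaOne fun a => p a ∨ q a := by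
  obtain ⟨R, hR, hpR⟩ := hp
  obtain ⟨Q, hQ, hqQ⟩ := hq
  refine ⟨fun x => R x ∨ Q x, hR.or hQ, fun a => ?_⟩
  simp only [hpR, hqQ, exists_or]

theorem mem_eval {c : α → Code} {n y : α → ℕ} (hc : Primrec c) (hn : Primrec n)
    (hy : Primrec y) : SigmaOne fun a => y a ∈ (c a).eval (n a) := by
  refine ⟨fun x => Code.evaln x.2 (c x.1) (n x.1) = some (y x.1),
    PrimrecPred.eq_comp (by fun_prop) (Primrec.option_some.comp (by fun_prop)), fun a => ?_⟩
  simp [Code.evaln_complete]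

theorem dom_eval {c : α → Code} {n : α → ℕ} (hc : Primrec c) (hn : Primrec n) :
    SigmaOne fun a => ((c a).eval (n a)).Dom := by
  refine (exists_denumerable (p := fun a y => y ∈ (c a).eval (n a))
    (mem_eval (by fun_prop) (by fun_prop) (by fun_prop))).congr fun a => ?_
  exact Part.dom_iff_mem

theorem exists_code {p : ℕ → Prop} (hp : SigmaOne p) :
    ∃ c : Code, ∀ n, p n ↔ (c.eval n).Dom := by
  obtain ⟨R, ⟨_, hR⟩, hpR⟩ := hp
  obtain ⟨c, hc⟩ := Code.exists_code.1 (Partrec.nat_iff.1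
    (Partrec.rfind (p := fun n z => Part.some (decide (R (n, z)))) hR.to_comp.partrec))
  refine ⟨c, fun n => ?_⟩
  rw [hc, hpR]
  exact (Nat.rfind_dom.trans (by simp)).symm

end SigmaOne

/-- A Σ⁰₃ predicate, presented as `∃ u, ∀ v` over a Σ⁰₁ matrix. -/
def SigmaThree (p : α → Prop) : Prop :=
  ∃ q : α × ℕ × ℕ → Prop, SigmaOne q ∧ ∀ a, p a ↔ ∃ u, ∀ v, q (a, u, v)

namespace SigmaThree

variable {p q : α → Prop}

theorem congr (hp : SigmaThree p) (h : ∀ a, q a ↔ p a) : SigmaThree q := by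
  obtain ⟨R, hR, hpR⟩ := hp
  exact ⟨R, hR, fun a => (h a).trans (hpR a)⟩

theorem comp {δ : Type*} [Primcodable δ] (hp : SigmaThree p) {f : δ → α} (hf : Primrec f) :
    SigmaThree fun a => p (f a) := by
  obtain ⟨R, hR, hpR⟩ := hp
  exact ⟨fun x => R (f x.1, x.2), hR.comp (by fun_prop), fun a => hpR (f a)⟩

theorem exists_forall {q : α → β → γ → Prop}
    (hq : SigmaOne fun x : α × β × γ => q x.1 x.2.1 x.2.2) :
    SigmaThree fun a => ∃ u, ∀ v, q a u v := by
  refine ⟨fun x => q x.1 (ofNat β x.2.1) (ofNat γ x.2.2),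
    hq.comp (f := fun x : α × ℕ × ℕ => (x.1, ofNat β x.2.1, ofNat γ x.2.2)) (by fun_prop),
    fun a => ⟨?_, ?_⟩⟩
  · rintro ⟨u, hu⟩
    exact ⟨Encodable.encode u, fun v => by simpa using hu _⟩
  · rintro ⟨u, hu⟩
    exact ⟨_, fun v => by simpa using hu (Encodable.encode v)⟩

theorem of_sigmaOne (hp : SigmaOne p) : SigmaThree p :=
  ⟨fun x => p x.1, hp.comp Primrec.fst, fun a => by simp⟩

theorem of_primrecPred (hp : PrimrecPred p) : SigmaThree p :=
  of_sigmaOne (.of_primrecPred hp)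

theorem not_sigmaOne (hp : SigmaOne p) : SigmaThree fun a => ¬p a := by
  obtain ⟨R, hR, hpR⟩ := hp
  refine ⟨fun x => ¬R (x.1, x.2.2),
    .of_primrecPred ((hR.comp (f := fun x : α × ℕ × ℕ => (x.1, x.2.2)) (by fun_prop)).not),
    fun a => ?_⟩
  simp [hpR]

theorem exists_denumerable {p : α → β → Prop} (hp : SigmaThree fun x : α × β => p x.1 x.2) :
    SigmaThree fun a => ∃ b, p a b := by
  obtain ⟨R, hR, hpR⟩ := hp
  refine (exists_forall (β := β × ℕ) (γ := ℕ) (q := fun a u v => R ((a, u.1), u.2, v))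
    (hR.comp (by fun_prop))).congr fun a => ?_
  simp only [Prod.exists]
  exact exists_congr fun b => hpR (a, b)

theorem or (hp : SigmaThree p) (hq : SigmaThree q) : SigmaThree fun a => p a ∨ q a := by
  obtain ⟨R, hR, hpR⟩ := hp
  obtain ⟨Q, hQ, hqQ⟩ := hq
  refine (exists_forall (β := ℕ × ℕ) (γ := ℕ)
    (q := fun a u v => (u.1 = 0 ∧ R (a, u.2, v)) ∨ (u.1 = 1 ∧ Q (a, u.2, v)))
    (((SigmaOne.of_primrecPred (PrimrecPred.eq_comp (by fun_prop) (by fun_prop))).and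
      (hR.comp (by fun_prop))).or
      ((SigmaOne.of_primrecPred (PrimrecPred.eq_comp (by fun_prop) (by fun_prop))).and
      (hQ.comp (by fun_prop))))).congr fun a => ?_
  rw [hpR, hqQ]
  constructor
  · rintro (⟨u, hu⟩ | ⟨u, hu⟩)
    · exact ⟨(0, u), fun v => .inl ⟨rfl, hu v⟩⟩
    · exact ⟨(1, u), fun v => .inr ⟨rfl, hu v⟩⟩
  · rintro ⟨⟨i, u⟩, hu⟩
    rcases hu 0 with ⟨h, _⟩ | ⟨h, _⟩
    · exact .inl ⟨u, fun v => by simpa [show i = 0 from h] using hu v⟩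
    · exact .inr ⟨u, fun v => by simpa [show i = 1 from h] using hu v⟩

theorem and (hp : SigmaThree p) (hq : SigmaThree q) : SigmaThree fun a => p a ∧ q a := by
  obtain ⟨R, hR, hpR⟩ := hp
  obtain ⟨Q, hQ, hqQ⟩ := hq
  refine (exists_forall (β := ℕ × ℕ) (γ := ℕ)
    (q := fun a u v => R (a, u.1, v) ∧ Q (a, u.2, v))
    ((hR.comp (by fun_prop)).and (hQ.comp (by fun_prop)))).congr fun a => ?_
  rw [hpR, hqQ]
  constructor
  · rintro ⟨⟨u, hu⟩, w, hw⟩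
    exact ⟨(u, w), fun v => ⟨hu v, hw v⟩⟩
  · rintro ⟨⟨u, w⟩, hu⟩
    exact ⟨⟨u, fun v => (hu v).1⟩, w, fun v => (hu v).2⟩

theorem isSigma03 {S : Set ℕ} (hS : SigmaThree (· ∈ S)) : IsSigma03 S := by
  obtain ⟨q, ⟨R, ⟨_, hR⟩, hqR⟩, hSq⟩ := hS
  refine ⟨fun n x y z => decide (R ((n, x, y), z)), ?_, fun n => ?_⟩
  · have hf : Primrec fun p : ℕ × ℕ × ℕ × ℕ => ((p.1, p.2.1, p.2.2.1), p.2.2.2) := by fun_prop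
    exact (hR.comp hf).to_comp
  · simp [hSq, hqR]

end SigmaThree

/-- `UniversalSigmaThree e n`: the number `n` belongs to the `e`-th Σ⁰₃ set. -/
def UniversalSigmaThree (e n : ℕ) : Prop :=
  ∃ u, ∀ v, ((ofNat Code e).eval (Nat.pair n (Nat.pair u v))).Dom

theorem sigmaThree_universal :
    SigmaThree fun x : ℕ × ℕ => UniversalSigmaThree x.1 x.2 :=
  SigmaThree.exists_forall (SigmaOne.dom_eval (by fun_prop) (by fun_prop))

theorem SigmaThree.exists_index {p : β × ℕ → Prop} (hp : SigmaThree p) :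
    ∃ x : β → ℕ, Primrec x ∧ ∀ b n, UniversalSigmaThree (x b) n ↔ p (b, n) := by
  obtain ⟨q, hq, hpq⟩ := hp
  obtain ⟨c, hc⟩ := SigmaOne.exists_code (hq.comp (f := fun m : ℕ =>
    ((ofNat β m.unpair.1, m.unpair.2.unpair.1), m.unpair.2.unpair.2.unpair.1,
      m.unpair.2.unpair.2.unpair.2)) (by fun_prop))
  refine ⟨fun b => Encodable.encode (c.curry (Encodable.encode b)),
    Primrec.encode.comp (Code.primrec₂_curry.comp (Primrec.const c) Primrec.encode),
    fun b n => ?_⟩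
  simp only [UniversalSigmaThree, ofNat_encode, Code.eval_curry, ← hc, hpq, Nat.unpair_pair]

end Arithmetical

section Ceers

theorem mem_W_iff {i n : ℕ} : n ∈ W i ↔ ∃ k, ((ofNat Code i).evaln k n).isSome := by
  simp only [W, Set.mem_ofPred_eq, Part.dom_iff_mem, Code.evaln_complete, Option.isSome_iff_exists]
  exact exists_comm

/-- One step of a path in the graph of `W i`: move from `a` to `e.unpair.1` if an edge between
these is found within `e.unpair.2` steps. -/
def ceerMove (i a e : ℕ) : ℕ :=
  if ((ofNat Code i).evaln e.unpair.2 (Nat.pair a e.unpair.1)).isSome = true ∨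
    ((ofNat Code i).evaln e.unpair.2 (Nat.pair e.unpair.1 a)).isSome = true
  then e.unpair.1 else a

theorem ceer_ceerMove (i a e : ℕ) : ceer i a (ceerMove i a e) := by
  unfold ceerMove
  split_ifs with h
  · rcases h with h | h
    · exact .rel _ _ (mem_W_iff.2 ⟨_, h⟩)
    · exact .symm _ _ (.rel _ _ (mem_W_iff.2 ⟨_, h⟩))
  · exact .refl _

theorem exists_ceerMove_symm (i a e : ℕ) : ∃ e', ceerMove i (ceerMove i a e) e' = a := by
  by_cases h : ceerMove i a e = a
  · exact ⟨e, by rw [h, h]⟩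
  · refine ⟨Nat.pair a e.unpair.2, ?_⟩
    unfold ceerMove at h ⊢
    split_ifs at h with h' <;> simp_all [or_comm]

theorem ceer_iff_foldl {i m n : ℕ} : ceer i m n ↔ ∃ L : List ℕ, L.foldl (ceerMove i) m = n := by
  constructor
  · intro h
    induction h with
    | rel a b h =>
      obtain ⟨k, hk⟩ := mem_W_iff.1 h
      exact ⟨[Nat.pair b k], by simp [ceerMove, hk]⟩
    | refl a => exact ⟨[], rfl⟩
    | symm a b _ ih =>
      obtain ⟨L, rfl⟩ := ih
      clear * -
      induction L generalizing a with
      | nil => exact ⟨[], rfl⟩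
      | cons e L ih =>
        obtain ⟨L', hL'⟩ := ih (ceerMove i a e)
        obtain ⟨e', he'⟩ := exists_ceerMove_symm i a e
        exact ⟨L' ++ [e'], by simp [hL', he']⟩
    | trans a b c _ _ ih ih' =>
      obtain ⟨L, rfl⟩ := ih
      obtain ⟨L', rfl⟩ := ih'
      exact ⟨L ++ L', by simp⟩
  · rintro ⟨L, rfl⟩
    induction L generalizing m with
    | nil => exact .refl _
    | cons e L ih => exact .trans _ _ _ (ceer_ceerMove i m e) ih

theorem primrec_ceerMove : Primrec fun x : ℕ × ℕ × ℕ => ceerMove x.1 x.2.1 x.2.2 := by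
  have isSome {f : ℕ × ℕ × ℕ → Option ℕ} (hf : Primrec f) :
      PrimrecPred fun x => (f x).isSome = true :=
    PrimrecPred.eq_comp (Primrec.option_isSome.comp hf) (by fun_prop)
  exact Primrec.ite ((isSome (by fun_prop)).or (isSome (by fun_prop))) (by fun_prop) (by fun_prop)

theorem primrec_foldl_ceerMove :
    Primrec fun x : (ℕ × ℕ × ℕ) × List ℕ => x.2.foldl (ceerMove x.1.1) x.1.2.1 := by
  have hf : Primrec fun x : ((ℕ × ℕ × ℕ) × List ℕ) × ℕ × ℕ => (x.1.1.1, x.2) := by fun_prop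
  exact Primrec.foldl_comp (f := fun x : (ℕ × ℕ × ℕ) × List ℕ => ceerMove x.1.1)
    (primrec_ceerMove.comp hf) (by fun_prop) (by fun_prop)

theorem primrecPred_foldl_ceerMove_eq : PrimrecPred fun x : (ℕ × ℕ × ℕ) × List ℕ =>
      x.2.foldl (ceerMove x.1.1) x.1.2.1 = x.1.2.2 :=
  PrimrecPred.eq_comp primrec_foldl_ceerMove (by fun_prop)

theorem sigmaOne_exists_foldl_ceerMove_eq :
    SigmaOne fun x : ℕ × ℕ × ℕ => ∃ L : List ℕ, L.foldl (ceerMove x.1) x.2.1 = x.2.2 :=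
  SigmaOne.exists_denumerable (.of_primrecPred primrecPred_foldl_ceerMove_eq)

theorem sigmaOne_ceer : SigmaOne fun x : ℕ × ℕ × ℕ => ceer x.1 x.2.1 x.2.2 :=
  sigmaOne_exists_foldl_ceerMove_eq.congr fun _ => ceer_iff_foldl

theorem sigmaThree_computableReduction :
    SigmaThree fun x : ℕ × ℕ => ComputableReduction (ceer x.1) (ceer x.2) := by
  obtain ⟨R, hR, hceer⟩ := sigmaOne_ceer
  have key : SigmaOne fun x : (ℕ × ℕ) × Code × ℕ × ℕ × ℕ => ∃ y : ℕ × ℕ,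
      y.1 ∈ x.2.1.eval x.2.2.1 ∧ y.2 ∈ x.2.1.eval x.2.2.2.1 ∧
      (¬R ((x.1.1, x.2.2.1, x.2.2.2.1), x.2.2.2.2) ∨ ceer x.1.2 y.1 y.2) ∧
      (¬R ((x.1.2, y.1, y.2), x.2.2.2.2) ∨ ceer x.1.1 x.2.2.1 x.2.2.2.1) := by
    refine SigmaOne.exists_denumerable (.and ?_ (.and ?_ (.and (.or ?_ ?_) (.or ?_ ?_))))
    · exact .mem_eval (by fun_prop) (by fun_prop) (by fun_prop)
    · exact .mem_eval (by fun_prop) (by fun_prop) (by fun_prop)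
    · exact .of_primrecPred (hR.comp (by fun_prop)).not
    · exact sigmaOne_ceer.comp
        (f := fun x : ((ℕ × ℕ) × Code × ℕ × ℕ × ℕ) × ℕ × ℕ => (x.1.1.2, x.2.1, x.2.2))
        (by fun_prop)
    · exact .of_primrecPred (hR.comp (by fun_prop)).not
    · exact sigmaOne_ceer.comp (f := fun x : ((ℕ × ℕ) × Code × ℕ × ℕ × ℕ) × ℕ × ℕ =>
        (x.1.1.1, x.1.2.2.1, x.1.2.2.2.1)) (by fun_prop)
  refine (SigmaThree.exists_forall (q := fun (a : ℕ × ℕ) (c : Code) (v : ℕ × ℕ × ℕ) =>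
    ∃ y : ℕ × ℕ, y.1 ∈ c.eval v.1 ∧ y.2 ∈ c.eval v.2.1 ∧
      (¬R ((a.1, v.1, v.2.1), v.2.2) ∨ ceer a.2 y.1 y.2) ∧
      (¬R ((a.2, y.1, y.2), v.2.2) ∨ ceer a.1 v.1 v.2.1)) key).congr ?_
  rintro ⟨i, j⟩
  have hi := fun m n => hceer (i, m, n)
  have hj := fun m n => hceer (j, m, n)
  simp only at hi hj ⊢
  constructor
  · rintro ⟨Φ, hΦ, h⟩
    obtain ⟨c, hc⟩ := Code.exists_code.1 (Partrec.nat_iff.1 hΦ)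
    refine ⟨c, fun ⟨m, n, s⟩ => ⟨(Φ m, Φ n), by simp [hc], by simp [hc], ?_, ?_⟩⟩
    · rw [← h, hi]
      exact not_or_of_imp fun hs => ⟨_, hs⟩
    · rw [h, hj]
      exact not_or_of_imp fun hs => ⟨_, hs⟩
  · rintro ⟨c, hc⟩
    have hd (m : ℕ) : ∃ y, y ∈ c.eval m := by
      obtain ⟨y, hy, _⟩ := hc (m, m, 0)
      exact ⟨_, hy⟩
    choose Φ hΦ using hd
    refine ⟨Φ, ?_, fun m n => ?_⟩
    · refine Partrec.nat_iff.2 (Code.exists_code.2 ⟨c, funext fun m => ?_⟩)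
      exact Part.eq_some_iff.2 (hΦ m)
    · have hc' (s : ℕ) : (R ((i, m, n), s) → ceer j (Φ m) (Φ n)) ∧
          (R ((j, Φ m, Φ n), s) → ceer i m n) := by
        obtain ⟨⟨a, b⟩, ha, hb, h1, h2⟩ := hc (m, n, s)
        obtain rfl := Part.mem_unique ha (hΦ m)
        obtain rfl := Part.mem_unique hb (hΦ n)
        exact ⟨h1.neg_resolve_left, h2.neg_resolve_left⟩
      constructor
      · intro h
        obtain ⟨s, hs⟩ := (hi m n).1 h
        exact (hc' s).1 hs
      · intro h
        obtain ⟨s, hs⟩ := (hj _ _).1 h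
        exact (hc' s).2 hs

theorem sigmaThree_ceerEquiv :
    SigmaThree fun x : ℕ × ℕ => CeerEquiv (ceer x.1) (ceer x.2) :=
  sigmaThree_computableReduction.and
    (sigmaThree_computableReduction.comp (f := Prod.swap) (Primrec.snd.pair Primrec.fst))

theorem ComputableReduction.trans {E F G : ℕ → ℕ → Prop} :
    ComputableReduction E F → ComputableReduction F G → ComputableReduction E G := by
  rintro ⟨Φ, hΦ, h⟩ ⟨Ψ, hΨ, h'⟩
  exact ⟨_, hΨ.comp hΦ, fun m n => (h m n).trans (h' _ _)⟩

theorem CeerEquiv.refl (E : ℕ → ℕ → Prop) : CeerEquiv E E :=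
  ⟨⟨_, Computable.id, fun _ _ => .rfl⟩, ⟨_, Computable.id, fun _ _ => .rfl⟩⟩

theorem CeerEquiv.symm {E F : ℕ → ℕ → Prop} (h : CeerEquiv E F) : CeerEquiv F E := And.symm h

theorem CeerEquiv.trans {E F G : ℕ → ℕ → Prop} (h : CeerEquiv E F) (h' : CeerEquiv F G) :
    CeerEquiv E G :=
  ⟨h.1.trans h'.1, h'.2.trans h.2⟩

theorem SigmaOne.exists_W_eq {p : ℕ → Prop} (hp : SigmaOne p) : ∃ e, ∀ n, n ∈ W e ↔ p n := by
  obtain ⟨c, hc⟩ := hp.exists_code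
  exact ⟨Encodable.encode c, fun n => by simp [W, hc]⟩

theorem exists_infinite_not_ceerEquiv :
    ∃ a b, HasInfinitelyManyClasses (ceer a) ∧ HasInfinitelyManyClasses (ceer b) ∧
      ¬CeerEquiv (ceer a) (ceer b) := by
  obtain ⟨a, ha⟩ := SigmaOne.exists_W_eq (p := fun _ => False)
    (.of_primrecPred (.of_eq (p := fun _ : ℕ => (0 : ℕ) = 1)
      (PrimrecPred.eq_comp (by fun_prop) (by fun_prop)) (by simp)))
  let K (n : ℕ) : Prop := ((ofNat Code n).eval 0).Dom
  obtain ⟨b, hb⟩ := SigmaOne.exists_W_eq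
    (p := fun m => ∃ n, m = Nat.pair (2 * n) (2 * n + 1) ∧ K n)
    (.exists_denumerable (.and (.of_primrecPred (PrimrecPred.eq_comp (by fun_prop) (by fun_prop)))
      (.dom_eval (by fun_prop) (by fun_prop))))
  have ha' (m n : ℕ) : ceer a m n ↔ m = n := by
    refine ⟨fun h => ?_, fun h => h ▸ .refl _⟩
    induction h with
    | rel x y h => exact ((ha _).1 h).elim
    | refl => rfl
    | symm _ _ _ ih => exact ih.symm
    | trans _ _ _ _ _ ih ih' => exact ih.trans ih'
  have hb' {m n : ℕ} (h : ceer b m n) : m = n ∨ m / 2 = n / 2 ∧ K (m / 2) := by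
    induction h with
    | rel x y h =>
      obtain ⟨n, hn, hK⟩ := (hb _).1 h
      obtain ⟨rfl, rfl⟩ := Nat.pair_eq_pair.1 hn
      right
      rw [show 2 * n / 2 = n by omega]
      exact ⟨by omega, hK⟩
    | refl => exact .inl rfl
    | symm _ _ _ ih => grind
    | trans _ _ _ _ _ ih ih' => grind
  refine ⟨a, b, ⟨id, fun m n h => by simpa [ha'] using h⟩,
    ⟨fun n => 2 * n, fun m n h h' => ?_⟩, ?_⟩
  · rcases hb' h' with h' | ⟨h', -⟩ <;> dsimp only at h' <;> omega
  · rintro ⟨-, Φ, hΦ, h⟩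
    have hK (n : ℕ) : K n ↔ Φ (2 * n) = Φ (2 * n + 1) := by
      rw [← ha', ← h]
      constructor
      · exact fun hn => .rel _ _ ((hb _).2 ⟨n, rfl, hn⟩)
      · intro hn
        rcases hb' hn with h' | ⟨-, h'⟩
        · omega
        · rwa [show 2 * n / 2 = n by omega] at h'
    refine ComputablePred.halting_problem 0 (ComputablePred.computable_iff.2
      ⟨fun c => decide (Φ (2 * Encodable.encode c) = Φ (2 * Encodable.encode c + 1)), ?_, ?_⟩)
    · have h1 : Computable fun c : Code => 2 * Encodable.encode c :=
        Primrec.to_comp (by fun_prop)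
      have h2 : Computable fun c : Code => 2 * Encodable.encode c + 1 :=
        Primrec.to_comp (by fun_prop)
      exact Primrec.eq.decide.to_comp.comp (hΦ.comp h1) (hΦ.comp h2)
    · funext c
      simp [← hK, K]

end Ceers

section Construction

/-- The partial computable function treated at stage `i`, where `g i` is its index. -/
def candidate (g : ℕ → ℕ) (i : ℕ) : ℕ →. ℕ := (ofNat Code (g i)).eval

/-- The Σ⁰₃ set used at the stage with history `P`: arguments at which the candidate function
diverges or takes a value equivalent to an index enumerated at a stage of opposite parity. -/
def Settled (g : ℕ → ℕ) (P : List ℕ) (n : ℕ) : Prop :=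
  ¬(candidate g P.length n).Dom ∨ ∃ z : ℕ × ℕ × ℕ, (z.1 + P.length) % 2 = 1 ∧
    P.getD z.1 0 = z.2.1 + 1 ∧ z.2.2 ∈ candidate g P.length n ∧
    CeerEquiv (ceer z.2.2) (ceer z.2.1)

theorem sigmaThree_settled {g : ℕ → ℕ} (hg : Primrec g) :
    SigmaThree fun x : List ℕ × ℕ => Settled g x.1 x.2 := by
  refine .or ?_ (.exists_denumerable (.and ?_ (.and ?_ (.and ?_ ?_))))
  · exact .not_sigmaOne (.dom_eval (by fun_prop) (by fun_prop))
  · exact .of_primrecPred (PrimrecPred.eq_comp (by fun_prop) (by fun_prop))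
  · exact .of_primrecPred (PrimrecPred.eq_comp (by fun_prop) (by fun_prop))
  · exact .of_sigmaOne (.mem_eval (by fun_prop) (by fun_prop) (by fun_prop))
  · exact sigmaThree_ceerEquiv.comp
      (f := fun x : (List ℕ × ℕ) × ℕ × ℕ × ℕ => (x.2.2.2, x.2.2.1)) (by fun_prop)

open Classical in
/-- The action taken after history `P`, where `x P` is an index of `Settled g P`: `0` for no
action, and `y + 1` for enumerating `y`. -/
noncomputable def action (g : ℕ → ℕ) (x : List ℕ → ℕ) (P : List ℕ) : ℕ :=
  if h : ¬UniversalSigmaThree (x P) (x P) ∧ (candidate g P.length (x P)).Dom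
  then (candidate g P.length (x P)).get h.2 + 1 else 0

/-- The history of the first `i` stages. -/
noncomputable def history (g : ℕ → ℕ) (x : List ℕ → ℕ) : ℕ → List ℕ
  | 0 => []
  | i + 1 => history g x i ++ [action g x (history g x i)]

/-- The indices enumerated at stages of parity `r`. -/
def enumerated (g : ℕ → ℕ) (x : List ℕ → ℕ) (r : ℕ) : Set ℕ :=
  {y | ∃ i, i % 2 = r ∧ action g x (history g x i) = y + 1}

variable {g : ℕ → ℕ} {x : List ℕ → ℕ}

theorem history_eq_map (i : ℕ) :
    history g x i = (List.range i).map fun j => action g x (history g x j) := by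
  induction i with
  | zero => rfl
  | succ i ih => rw [history, List.range_succ, List.map_append, ← ih]; rfl

theorem length_history (i : ℕ) : (history g x i).length = i := by
  rw [history_eq_map, List.length_map, List.length_range]

theorem getD_map_range (f : ℕ → ℕ) (i j : ℕ) :
    ((List.range i).map f).getD j 0 = if j < i then f j else 0 := by
  split_ifs with h <;> simp [List.getD_eq_getElem?_getD, h]

theorem getD_history_of_lt {i j : ℕ} (h : j < i) :
    (history g x i).getD j 0 = action g x (history g x j) := by
  rw [history_eq_map, getD_map_range, if_pos h]

theorem getD_history_eq_succ {i j y : ℕ} (h : (history g x i).getD j 0 = y + 1) :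
    action g x (history g x j) = y + 1 := by
  rw [history_eq_map, getD_map_range] at h
  split_ifs at h
  exact h

theorem action_eq_succ_iff {P : List ℕ} {y : ℕ} : action g x P = y + 1 ↔
    ¬UniversalSigmaThree (x P) (x P) ∧ y ∈ candidate g P.length (x P) := by
  unfold action
  split_ifs with h
  · simp [h.1, Part.mem_eq, h.2]
  · simp only [not_and] at h
    refine iff_of_false (by simp) fun h' => h h'.1 (Part.dom_iff_mem.2 ⟨y, h'.2⟩)

theorem not_ceerEquiv_of_lt (hx : ∀ P n, UniversalSigmaThree (x P) n ↔ Settled g P n)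
    {i j y z : ℕ} (hji : j < i) (hpar : (j + i) % 2 = 1)
    (hi : action g x (history g x i) = y + 1) (hj : action g x (history g x j) = z + 1) :
    ¬CeerEquiv (ceer y) (ceer z) := by
  obtain ⟨hU, hy⟩ := action_eq_succ_iff.1 hi
  rw [hx] at hU
  exact fun h => hU (.inr ⟨(j, z, y), by rwa [length_history], by rwa [getD_history_of_lt hji],
    hy, h⟩)

theorem not_ceerEquiv_of_mem_enumerated
    (hx : ∀ P n, UniversalSigmaThree (x P) n ↔ Settled g P n) {y z : ℕ}
    (hy : y ∈ enumerated g x 0) (hz : z ∈ enumerated g x 1) : ¬CeerEquiv (ceer y) (ceer z) := by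
  obtain ⟨i, hi, hiy⟩ := hy
  obtain ⟨j, hj, hjz⟩ := hz
  rcases lt_or_gt_of_ne (show i ≠ j by omega) with h | h
  · exact fun h' => not_ceerEquiv_of_lt hx h (by omega) hjz hiy h'.symm
  · exact not_ceerEquiv_of_lt hx h (by omega) hiy hjz

theorem notMem_ceerClosure_enumerated
    (hx : ∀ P n, UniversalSigmaThree (x P) n ↔ Settled g P n) {a y : ℕ}
    (hy : y ∈ enumerated g x 0) (h : CeerEquiv (ceer a) (ceer y)) :
    a ∉ ceerClosure (enumerated g x 1) := by
  rintro ⟨z, hz, haz⟩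
  exact not_ceerEquiv_of_mem_enumerated hx hy hz (h.symm.trans haz)

/-- At a stage with total candidate function `f`, the diagonal argument `n` either lies in the
diagonal Σ⁰₃ set and `f n` is equivalent to an index enumerated with the opposite parity, or lies
outside it and `f n` is enumerated. -/
theorem exists_diagonal (hx : ∀ P n, UniversalSigmaThree (x P) n ↔ Settled g P n)
    {f : ℕ → ℕ} {i r : ℕ} (hf : candidate g i = f) (hr : r < 2) (hi : i % 2 = r) :
    ∃ n, (UniversalSigmaThree n n ∧
        ∃ y ∈ enumerated g x (1 - r), CeerEquiv (ceer (f n)) (ceer y)) ∨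
      (¬UniversalSigmaThree n n ∧ f n ∈ enumerated g x r) := by
  refine ⟨x (history g x i), ?_⟩
  by_cases hU : UniversalSigmaThree (x (history g x i)) (x (history g x i))
  · refine .inl ⟨hU, ?_⟩
    rw [hx, Settled, length_history, hf] at hU
    rcases hU with hU | ⟨⟨j, y, a⟩, hpar, hj, ha, h⟩
    · exact (hU trivial).elim
    · obtain rfl : a = _ := by simpa using ha
      dsimp only at hpar hj
      exact ⟨y, ⟨j, by omega, getD_history_eq_succ hj⟩, h⟩
  · exact .inr ⟨hU, i, hi, action_eq_succ_iff.2 ⟨hU, by simp [length_history, hf]⟩⟩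

/-- The history of length `k` recorded in the first components of `L`. -/
def recorded (L : List ℕ) (k : ℕ) : List ℕ :=
  (List.range k).map fun j => (L.getD j 0).unpair.1

@[fun_prop]
theorem Primrec.recorded_comp {α : Type*} [Primcodable α] {f : α → List ℕ} {k : α → ℕ}
    (hf : Primrec f) (hk : Primrec k) : Primrec fun a => recorded (f a) (k a) := by
  have h : Primrec₂ fun (a : α) (j : ℕ) => ((f a).getD j 0).unpair.1 := by
    unfold Primrec₂
    fun_prop
  exact Primrec.list_map (Primrec.list_range.comp hk) h

/-- The entry of `L` at `k` correctly records an action after the recorded history, with a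
witness in its second component when there is no action. -/
def ValidEntry (g : ℕ → ℕ) (x : List ℕ → ℕ) (L : List ℕ) (k : ℕ) : Prop :=
  ((L.getD k 0).unpair.1 = 0 ∧ ∀ v, ((ofNat Code (x (recorded L k))).eval
      (Nat.pair (x (recorded L k)) (Nat.pair (L.getD k 0).unpair.2 v))).Dom) ∨
    (¬UniversalSigmaThree (x (recorded L k)) (x (recorded L k)) ∧
      ∃ y, (L.getD k 0).unpair.1 = y + 1 ∧ y ∈ candidate g k (x (recorded L k)))

/-- `L` certifies that `y` is enumerated at the odd stage `i`. -/
def Certifies (g : ℕ → ℕ) (x : List ℕ → ℕ) (y i : ℕ) (L : List ℕ) : Prop :=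
  i % 2 = 1 ∧ (L.getD i 0).unpair.1 = y + 1 ∧ ∀ k ≤ i, ValidEntry g x L k

theorem sigmaThree_not_validEntry (hg : Primrec g) (hx : Primrec x) :
    SigmaThree fun a : List ℕ × ℕ => ¬ValidEntry g x a.1 a.2 := by
  have h : SigmaThree fun a : List ℕ × ℕ =>
      (¬((a.1.getD a.2 0).unpair.1 = 0) ∨ ∃ v, ¬((ofNat Code (x (recorded a.1 a.2))).eval
        (Nat.pair (x (recorded a.1 a.2)) (Nat.pair (a.1.getD a.2 0).unpair.2 v))).Dom) ∧
      (UniversalSigmaThree (x (recorded a.1 a.2)) (x (recorded a.1 a.2)) ∨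
      ¬∃ y, (a.1.getD a.2 0).unpair.1 = y + 1 ∧ y ∈ candidate g a.2 (x (recorded a.1 a.2))) := by
    refine .and (.or ?_ (.exists_denumerable ?_)) (.or ?_ ?_)
    · exact .not_sigmaOne (.of_primrecPred (PrimrecPred.eq_comp (by fun_prop) (by fun_prop)))
    · exact .not_sigmaOne (.dom_eval (by fun_prop) (by fun_prop))
    · exact sigmaThree_universal.comp
        (f := fun a : List ℕ × ℕ => (x (recorded a.1 a.2), x (recorded a.1 a.2))) (by fun_prop)
    · exact .not_sigmaOne (.exists_denumerable (.and
        (.of_primrecPred (PrimrecPred.eq_comp (by fun_prop) (by fun_prop)))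
        (.mem_eval (by fun_prop) (by fun_prop) (by fun_prop))))
  refine h.congr fun a => ?_
  simp only [ValidEntry]
  grind

theorem sigmaThree_not_certifies (hg : Primrec g) (hx : Primrec x) :
    SigmaThree fun a : ℕ × ℕ × List ℕ => ¬Certifies g x a.1 a.2.1 a.2.2 := by
  have h : SigmaThree fun a : ℕ × ℕ × List ℕ => ¬(a.2.1 % 2 = 1) ∨
      ¬((a.2.2.getD a.2.1 0).unpair.1 = a.1 + 1) ∨
      ∃ k, k ≤ a.2.1 ∧ ¬ValidEntry g x a.2.2 k := by
    refine .or ?_ (.or ?_ (.exists_denumerable (.and ?_ ?_)))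
    · exact .not_sigmaOne (.of_primrecPred (PrimrecPred.eq_comp (by fun_prop) (by fun_prop)))
    · exact .not_sigmaOne (.of_primrecPred (PrimrecPred.eq_comp (by fun_prop) (by fun_prop)))
    · exact .of_primrecPred (Primrec.nat_le.comp (by fun_prop) (by fun_prop))
    · exact (sigmaThree_not_validEntry hg hx).comp
        (f := fun a : (ℕ × ℕ × List ℕ) × ℕ => (a.1.2.2, a.2)) (by fun_prop)
  refine h.congr fun a => ?_
  simp only [Certifies]
  grind

theorem recorded_eq_history {L : List ℕ} {k : ℕ}
    (h : ∀ j < k, (L.getD j 0).unpair.1 = action g x (history g x j)) :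
    recorded L k = history g x k := by
  rw [history_eq_map, recorded]
  exact List.map_congr_left fun j hj => h j (List.mem_range.1 hj)

theorem unpair_fst_eq_action {L : List ℕ} {i : ℕ} (hL : ∀ k ≤ i, ValidEntry g x L k) (k : ℕ)
    (hk : k ≤ i) : (L.getD k 0).unpair.1 = action g x (history g x k) := by
  induction k using Nat.strong_induction_on with
  | _ k ih =>
    have hrec : recorded L k = history g x k :=
      recorded_eq_history fun j hj => ih j hj (by omega)
    have hval := hL k hk
    rw [ValidEntry, hrec] at hval
    rcases hval with ⟨h0, h⟩ | ⟨hU, y, hy, h⟩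
    · rw [h0, action, dif_neg]
      exact fun h' => h'.1 ⟨_, h⟩
    · rw [hy, action_eq_succ_iff.2 ⟨hU, by rwa [length_history]⟩]

theorem mem_enumerated_iff (hx : ∀ P n, UniversalSigmaThree (x P) n ↔ Settled g P n) {y : ℕ} :
    y ∈ enumerated g x 1 ↔ ∃ i L, Certifies g x y i L := by
  constructor
  · rintro ⟨i, hi, hy⟩
    have hw (k : ℕ) : ∃ w, UniversalSigmaThree (x (history g x k)) (x (history g x k)) →
        ∀ v, ((ofNat Code (x (history g x k))).eval
          (Nat.pair (x (history g x k)) (Nat.pair w v))).Dom := by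
      by_cases hU : UniversalSigmaThree (x (history g x k)) (x (history g x k))
      · exact hU.imp fun w h _ => h
      · exact ⟨0, fun h => (hU h).elim⟩
    choose w hw using hw
    let L := (List.range (i + 1)).map fun k => Nat.pair (action g x (history g x k)) (w k)
    have hL (k : ℕ) (hk : k ≤ i) :
        L.getD k 0 = Nat.pair (action g x (history g x k)) (w k) := by
      rw [getD_map_range, if_pos (by omega)]
    refine ⟨i, L, hi, by rwa [hL i le_rfl, Nat.unpair_pair], fun k hk => ?_⟩
    have hrec : recorded L k = history g x k :=
      recorded_eq_history fun j hj => by rw [hL j (by omega), Nat.unpair_pair]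
    rw [ValidEntry, hrec, hL k hk, Nat.unpair_pair]
    by_cases hU : UniversalSigmaThree (x (history g x k)) (x (history g x k))
    · exact .inl ⟨dif_neg fun h => h.1 hU, hw k hU⟩
    · have hd : (candidate g k (x (history g x k))).Dom := by
        rw [hx, Settled, length_history] at hU
        exact not_not.1 fun h => hU (.inl h)
      obtain ⟨z, hz⟩ := Part.dom_iff_mem.1 hd
      exact .inr ⟨hU, z, action_eq_succ_iff.2 ⟨hU, by rwa [length_history]⟩, hz⟩
  · rintro ⟨i, L, hi, hy, hL⟩
    exact ⟨i, hi, (unpair_fst_eq_action hL i le_rfl).symm.trans hy⟩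

/-- An index of the same c.e. set as `y`, from which `c` can be recovered. -/
def pad (y c : ℕ) : ℕ :=
  Encodable.encode (Code.comp (Code.prec (ofNat Code y) (ofNat Code c)) (Code.pair Code.id .zero))

/-- The left inverse of `pad`. -/
def unpad (t : ℕ) : ℕ × ℕ := ((((t - 4) / 4).unpair.1 - 5) / 4).unpair

theorem unpad_pad (y c : ℕ) : unpad (pad y c) = (y, c) := by
  have h (n : ℕ) : (ofNat Code n).encodeCode = n := encode_ofNat (α := Code) n
  simp only [unpad, pad, Code.encodeCode_eq, Code.encodeCode, h]
  rw [show ∀ n, (2 * (2 * n + 1) + 4 - 4) / 4 = n by omega, Nat.unpair_pair,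
    show ∀ n, (2 * (2 * n) + 1 + 4 - 5) / 4 = n by omega, Nat.unpair_pair]

theorem primrec_pad : Primrec fun a : ℕ × ℕ => pad a.1 a.2 :=
  Primrec.encode.comp (Code.primrec₂_comp.comp
    (Code.primrec₂_prec.comp (by fun_prop) (by fun_prop)) (by fun_prop))

theorem W_pad (y c : ℕ) : W (pad y c) = W y := by
  ext n
  have h : (Code.pair Code.id .zero).eval n = Part.some (Nat.pair n 0) := by
    change Nat.pair <$> Code.id.eval n <*> Part.some 0 = _
    simp [Code.eval_id, Seq.seq]
  simp only [W, pad, Set.mem_ofPred_eq, ofNat_encode]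
  change (((Code.pair Code.id .zero).eval n).bind
    fun m => ((ofNat Code y).prec (ofNat Code c)).eval m).Dom ↔ _
  rw [h, Part.bind_some, Code.eval_prec_zero]

theorem ceer_pad (y c : ℕ) : ceer (pad y c) = ceer y := by
  unfold ceer
  rw [W_pad]

/-- The padded certified indices. -/
def certified (g : ℕ → ℕ) (x : List ℕ → ℕ) : Set ℕ :=
  {t | t = pad (unpad t).1 (unpad t).2 ∧ Certifies g x (unpad t).1 (unpad t).2.unpair.1
    (ofNat (List ℕ) (unpad t).2.unpair.2)}

theorem isPi03_certified (hg : Primrec g) (hx : Primrec x) : IsPi03 (certified g x) := by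
  have hunpad : Primrec unpad := by
    unfold unpad
    fun_prop
  have h : SigmaThree fun t : ℕ => ¬(t = pad (unpad t).1 (unpad t).2) ∨
      ¬Certifies g x (unpad t).1 (unpad t).2.unpair.1 (ofNat (List ℕ) (unpad t).2.unpair.2) := by
    refine .or ?_ ?_
    · exact .of_primrecPred (PrimrecPred.eq_comp (by fun_prop)
        (primrec_pad.comp (by fun_prop))).not
    · exact (sigmaThree_not_certifies hg hx).comp (f := fun t : ℕ =>
        ((unpad t).1, (unpad t).2.unpair.1, ofNat (List ℕ) (unpad t).2.unpair.2)) (by fun_prop)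
  exact (h.congr fun t => not_and_or).isSigma03

theorem ceerClosure_certified
    (hx : ∀ P n, UniversalSigmaThree (x P) n ↔ Settled g P n) :
    ceerClosure (certified g x) = ceerClosure (enumerated g x 1) := by
  ext a
  constructor
  · rintro ⟨t, ⟨ht, hc⟩, h⟩
    rw [ht, ceer_pad] at h
    exact ⟨_, (mem_enumerated_iff hx).2 ⟨_, _, hc⟩, h⟩
  · rintro ⟨y, hy, h⟩
    obtain ⟨i, L, hL⟩ := (mem_enumerated_iff hx).1 hy
    refine ⟨pad y (Nat.pair i (Encodable.encode L)), ?_, by rwa [ceer_pad]⟩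
    simpa [certified, unpad_pad] using hL

end Construction

/-- There is a Π⁰₃ set `T` which is proper on the infinite ceers such that `[T]` is
neither Σ⁰₃-hard nor Π⁰₃-hard with respect to many-one reducibility. -/
theorem exists_Pi03_proper_closure_not_Sigma03_or_Pi03_hard :
    ∃ T : Set ℕ, IsPi03 T ∧ ProperOnInfiniteCeers T ∧
      (∃ A : Set ℕ, IsSigma03 A ∧ ¬(· ∈ A) ≤₀ (· ∈ ceerClosure T)) ∧
      (∃ B : Set ℕ, IsPi03 B ∧ ¬(· ∈ B) ≤₀ (· ∈ ceerClosure T)) := by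
  obtain ⟨a, b, ha, hb, hab⟩ := exists_infinite_not_ceerEquiv
  let g (i : ℕ) : ℕ := if i = 0 then Encodable.encode (Code.const a) else
    if i = 1 then Encodable.encode (Code.const b) else i / 2 - 1
  have hg : Primrec g :=
    .ite (PrimrecPred.eq_comp (by fun_prop) (by fun_prop)) (by fun_prop)
      (.ite (PrimrecPred.eq_comp (by fun_prop) (by fun_prop)) (by fun_prop) (by fun_prop))
  obtain ⟨x, hxp, hx⟩ := (sigmaThree_settled hg).exists_index
  replace hx (P n) : UniversalSigmaThree (x P) n ↔ Settled g P n := hx P n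
  have hg0 : candidate g 0 = fun _ => Part.some a := by
    funext n
    simp [candidate, g]
  have hg1 : candidate g 1 = fun _ => Part.some b := by
    funext n
    simp [candidate, g]
  have h0 : action g x (history g x 0) = a + 1 := by
    rw [action_eq_succ_iff, hx, Settled, length_history, hg0]
    simp [history]
  have h1 : action g x (history g x 1) = b + 1 := by
    rw [action_eq_succ_iff, hx, Settled, length_history, hg1]
    refine ⟨?_, Part.mem_some b⟩
    rintro (h | ⟨⟨j, y, z⟩, hj, hy, hz, h⟩)
    · exact h trivial
    · obtain rfl : z = b := by simpa using hz
      dsimp only at hj hy h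
      rw [history_eq_map, getD_map_range] at hy
      split_ifs at hy with hj'
      obtain rfl : j = 0 := by omega
      obtain rfl : a = y := by omega
      exact hab h.symm
  have hstage {f : ℕ → ℕ} (hf : Computable f) (r : ℕ) (hr : r < 2) :
      ∃ i, i % 2 = r ∧ candidate g i = f := by
    obtain ⟨c, hc⟩ := Code.exists_code.1 (Partrec.nat_iff.1 hf)
    refine ⟨2 * (Encodable.encode c + 1) + r, by omega, ?_⟩
    have h : g (2 * (Encodable.encode c + 1) + r) = Encodable.encode c := by
      simp only [g]
      rw [if_neg (by omega), if_neg (by omega)]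
      omega
    rw [candidate, h, ofNat_encode, hc]
  have hdiag : SigmaThree fun n : ℕ => UniversalSigmaThree n n :=
    sigmaThree_universal.comp (Primrec.id.pair Primrec.id)
  refine ⟨certified g x, isPi03_certified hg hxp, ?_, ?_, ?_⟩ <;>
    simp only [ProperOnInfiniteCeers, ceerClosure_certified hx]
  · exact ⟨b, a, hb, ha, ⟨b, ⟨1, rfl, h1⟩, .refl _⟩,
      notMem_ceerClosure_enumerated hx ⟨0, rfl, h0⟩ (.refl _)⟩
  · refine ⟨{n | UniversalSigmaThree n n}, hdiag.isSigma03, ?_⟩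
    rintro ⟨f, hf, h⟩
    obtain ⟨i, hi, hfi⟩ := hstage hf 1 (by omega)
    obtain ⟨n, ⟨hU, y, hy, hn⟩ | ⟨hU, hn⟩⟩ := exists_diagonal hx hfi (by omega) hi
    · exact notMem_ceerClosure_enumerated hx hy hn ((h n).1 hU)
    · exact hU ((h n).2 ⟨_, hn, .refl _⟩)
  · refine ⟨{n | ¬UniversalSigmaThree n n},
      (hdiag.congr fun n => not_not).isSigma03, ?_⟩
    rintro ⟨f, hf, h⟩
    obtain ⟨i, hi, hfi⟩ := hstage hf 0 (by omega)
    obtain ⟨n, ⟨hU, y, hy, hn⟩ | ⟨hU, hn⟩⟩ := exists_diagonal hx hfi (by omega) hi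
    · exact (h n).2 ⟨y, hy, hn⟩ hU
    · exact notMem_ceerClosure_enumerated hx hn (.refl _) ((h n).1 hU)
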